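/- arXiv:math/0106121 — 2 statements merged into one kernel-verified Lean document; each statement's English description precedes it below -/
import Mathlib

section
/- Let w = (w_n)_{n ≥ 0} be a complementation-symmetric sequence on a two-letter alphabet whose block complexity satisfies fac_w(k) = 2k for all k ≥ 1. Then its palindrome complexity satisfies pal_w(k) = 2 for all k ≥ 1. -/
namespace PalPaper

variable {α : Type*}

/-- The finite word `u i, u (i+1), …, u (i+k-1)` read off the infinite sequence `u`. -/
def factorAt (u : ℕ → α) (i k : ℕ) : List α :=
  (List.range k).map fun j => u (i + j)

/-- `w` occurs as a contiguous block (factor) in the infinite sequence `u`. -/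
def IsFactor (u : ℕ → α) (w : List α) : Prop :=
  ∃ i, w = factorAt u i w.length

/-- A palindrome is a word equal to its reversal. -/
def IsPalindrome (w : List α) : Prop := w.reverse = w

/-- Number of distinct factors of length `k` of `u`. -/
noncomputable def facComplexity (u : ℕ → α) (k : ℕ) : ℕ :=
  Set.ncard {w : List α | w.length = k ∧ IsFactor u w}

/-- Number of distinct palindromic factors of length `k` of `u`. -/
noncomputable def palComplexity (u : ℕ → α) (k : ℕ) : ℕ :=
  Set.ncard {w : List α | w.length = k ∧ IsFactor u w ∧ IsPalindrome w}

/-- `p ≥ 1` is a period of the finite word `w`. -/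
def IsPeriodOf (p : ℕ) (w : List α) : Prop :=
  1 ≤ p ∧ ∀ i (h : i + p < w.length), w[i]'(by omega) = w[i + p]'h

/-- The minimal period of a finite word. -/
noncomputable def minPeriod (w : List α) : ℕ := sInf {p | IsPeriodOf p w}

/-- The prefix of length `m` of the infinite sequence `u`, as a finite word. -/
def seqPrefix (u : ℕ → α) (m : ℕ) : List α := (List.range m).map u

/-- The word `σ(u 0) σ(u 1) ⋯ σ(u (n-1))`. -/
def substPrefix (σ : α → List α) (u : ℕ → α) (n : ℕ) : List α :=
  (List.range n).flatMap fun i => σ (u i)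

/-- `v = σ(u)`: every word `σ(u 0) ⋯ σ(u (n-1))` is the corresponding prefix of `v`. -/
def IsMorphicImage (σ : α → List α) (u v : ℕ → α) : Prop :=
  ∀ n, substPrefix σ u n = seqPrefix v (substPrefix σ u n).length

/-- `u` is a fixed point of the morphism `σ`, i.e. `σ(u) = u`. -/
def IsFixedPointOf (σ : α → List α) (u : ℕ → α) : Prop := IsMorphicImage σ u u

/-- The `k`-th iterate of a morphism, applied to a letter. -/
def morphIter (σ : α → List α) : ℕ → α → List α
  | 0, a => [a]
  | k + 1, a => (σ a).flatMap (morphIter σ k)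

/-- A morphism is primitive if some iterate maps every letter to a word
containing every letter. -/
def IsPrimitive (σ : α → List α) : Prop :=
  ∃ k, 1 ≤ k ∧ ∀ a b : α, b ∈ morphIter σ k a

section Factors

variable (u : ℕ → α)

theorem length_factorAt (i k : ℕ) : (factorAt u i k).length = k := by
  simp [factorAt]

theorem getElem_factorAt (i k j : ℕ) (h : j < (factorAt u i k).length) :
    (factorAt u i k)[j] = u (i + j) := by
  simp [factorAt]

theorem factorAt_succ (i k : ℕ) : factorAt u i (k + 1) = factorAt u i k ++ [u (i + k)] := by
  simp [factorAt, List.range_succ]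

theorem factorAt_succ' (i k : ℕ) : factorAt u i (k + 1) = u i :: factorAt u (i + 1) k := by
  simp [factorAt, List.range_succ_eq_map, Function.comp_def, Nat.add_assoc, Nat.add_comm 1]

theorem isFactor_factorAt (i k : ℕ) : IsFactor u (factorAt u i k) :=
  ⟨i, by rw [length_factorAt]⟩

variable {u}

theorem IsFactor.exists_eq {l : List α} (h : IsFactor u l) {k : ℕ} (hk : l.length = k) :
    ∃ i, l = factorAt u i k := by
  subst hk; exact h

theorem IsFactor.of_cons {a : α} {l : List α} (h : IsFactor u (a :: l)) : IsFactor u l := by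
  obtain ⟨i, hi⟩ := h.exists_eq (List.length_cons)
  rw [factorAt_succ', List.cons.injEq] at hi
  rw [hi.2]
  exact isFactor_factorAt u _ _

theorem IsFactor.of_append_singleton {b : α} {l : List α} (h : IsFactor u (l ++ [b])) :
    IsFactor u l := by
  obtain ⟨i, hi⟩ := h.exists_eq (k := l.length + 1) (by simp)
  rw [factorAt_succ] at hi
  rw [(List.append_inj hi (by simp [length_factorAt])).1]
  exact isFactor_factorAt u _ _

theorem IsFactor.exists_append_singleton {l : List α} (h : IsFactor u l) :
    ∃ b, IsFactor u (l ++ [b]) := by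
  obtain ⟨i, hi⟩ := h
  refine ⟨u (i + l.length), ?_⟩
  have := isFactor_factorAt u i (l.length + 1)
  rwa [factorAt_succ, ← hi] at this

theorem finite_factors [Finite α] (u : ℕ → α) (k : ℕ) :
    {l : List α | l.length = k ∧ IsFactor u l}.Finite :=
  (List.finite_length_eq α k).subset fun _ h => h.1

end Factors

/-- A word is right special if all of its one-letter right extensions are factors. -/
def IsRightSpecial (u : ℕ → α) (l : List α) : Prop := ∀ b, IsFactor u (l ++ [b])

theorem IsRightSpecial.isFactor {u : ℕ → Bool} {l : List Bool} (h : IsRightSpecial u l) :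
    IsFactor u l := (h true).of_append_singleton

theorem IsRightSpecial.of_cons {u : ℕ → α} {a : α} {l : List α}
    (h : IsRightSpecial u (a :: l)) : IsRightSpecial u l := fun b => (h b).of_cons

theorem isRightSpecial_of_ne {u : ℕ → Bool} {l : List Bool} {a b : Bool} (hab : a ≠ b)
    (ha : IsFactor u (l ++ [a])) (hb : IsFactor u (l ++ [b])) : IsRightSpecial u l := by
  intro c
  cases a <;> cases b <;> cases c <;> simp_all

theorem facComplexity_succ (u : ℕ → Bool) (n : ℕ) :
    facComplexity u (n + 1) =
      facComplexity u n + Set.ncard {r | r.length = n ∧ IsRightSpecial u r} := by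
  let F : Bool → Set (List Bool) := fun b => {l | l.length = n ∧ IsFactor u (l ++ [b])}
  have hF : ∀ b, (F b).Finite := fun b => (List.finite_length_eq Bool n).subset fun _ h => h.1
  have hinj : ∀ b : Bool, Function.Injective fun l : List Bool => l ++ [b] :=
    fun b l l' h => List.append_cancel_right h
  have h1 : {l : List Bool | l.length = n ∧ IsFactor u l} = F true ∪ F false := by
    ext l
    constructor
    · rintro ⟨hl, h⟩
      obtain ⟨b, hb⟩ := h.exists_append_singleton
      cases b
      · exact Or.inr ⟨hl, hb⟩
      · exact Or.inl ⟨hl, hb⟩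
    · rintro (⟨hl, h⟩ | ⟨hl, h⟩) <;> exact ⟨hl, h.of_append_singleton⟩
  have h2 : {r | r.length = n ∧ IsRightSpecial u r} = F true ∩ F false := by
    ext l
    constructor
    · rintro ⟨hl, h⟩
      exact ⟨⟨hl, h _⟩, ⟨hl, h _⟩⟩
    · rintro ⟨⟨hl, h⟩, ⟨_, h'⟩⟩
      exact ⟨hl, isRightSpecial_of_ne (by decide) h h'⟩
  have h3 : {l : List Bool | l.length = n + 1 ∧ IsFactor u l} =
      (fun l => l ++ [true]) '' F true ∪ (fun l => l ++ [false]) '' F false := by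
    ext l
    constructor
    · rintro ⟨hl, h⟩
      rcases List.eq_nil_or_concat' l with rfl | ⟨l, b, rfl⟩
      · simp at hl
      · have hl' : l.length = n := by simpa using hl
        cases b
        · exact Or.inr ⟨l, ⟨hl', h⟩, rfl⟩
        · exact Or.inl ⟨l, ⟨hl', h⟩, rfl⟩
    · rintro (⟨l, ⟨hl, h⟩, rfl⟩ | ⟨l, ⟨hl, h⟩, rfl⟩) <;> exact ⟨by simpa using hl, h⟩
  unfold facComplexity
  rw [h1, h2, h3, Set.ncard_union_add_ncard_inter _ _ (hF _) (hF _),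
    Set.ncard_union_eq _ ((hF _).image _) ((hF _).image _),
    Set.ncard_image_of_injective _ (hinj _), Set.ncard_image_of_injective _ (hinj _)]
  rw [Set.disjoint_left]
  rintro _ ⟨l, -, rfl⟩ ⟨l', -, h⟩
  have := (List.append_inj' h rfl).2
  simp at this

theorem factorAt_succ_eq_of_not_isRightSpecial {u : ℕ → Bool} {i j n : ℕ}
    (hr : ¬ IsRightSpecial u (factorAt u i n)) (h : factorAt u i n = factorAt u j n) :
    factorAt u i (n + 1) = factorAt u j (n + 1) := by
  by_contra hne
  have hij : u (i + n) ≠ u (j + n) := by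
    intro h'
    exact hne (by rw [factorAt_succ, factorAt_succ, h, h'])
  refine hr (isRightSpecial_of_ne hij ?_ ?_)
  · rw [← factorAt_succ]; exact isFactor_factorAt u _ _
  · rw [h, ← factorAt_succ]; exact isFactor_factorAt u _ _

/-- If a window repeats and no right special window occurs in between, the sequence is
eventually periodic, hence of bounded complexity. -/
theorem facComplexity_le_of_window_eq {u : ℕ → Bool} {n p q : ℕ} (hpq : p < q)
    (h : factorAt u p n = factorAt u q n)
    (hr : ∀ t, p ≤ t → t < q → ¬ IsRightSpecial u (factorAt u t n)) (m : ℕ) :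
    facComplexity u m ≤ q := by
  have red : ∀ s, ∃ t, p ≤ t ∧ t < q ∧ factorAt u (p + s) n = factorAt u t n := by
    intro s
    induction s with
    | zero => exact ⟨p, le_rfl, hpq, rfl⟩
    | succ s ih =>
      obtain ⟨t, hpt, htq, e⟩ := ih
      have e' := factorAt_succ_eq_of_not_isRightSpecial (e ▸ hr t hpt htq) e
      rw [factorAt_succ', factorAt_succ', List.cons.injEq] at e'
      rcases Nat.lt_or_ge (t + 1) q with h1 | h1
      · exact ⟨t + 1, by omega, h1, e'.2⟩
      · have : t + 1 = q := by omega
        exact ⟨p, le_rfl, hpq, by rw [h, ← this]; exact e'.2⟩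
  have nr : ∀ s, p ≤ s → ¬ IsRightSpecial u (factorAt u s n) := by
    intro s hs
    obtain ⟨t, hpt, htq, e⟩ := red (s - p)
    rw [Nat.add_sub_cancel' hs] at e
    rw [e]
    exact hr t hpt htq
  have next : ∀ k i j, p ≤ i → p ≤ j → factorAt u i n = factorAt u j n →
      factorAt u (i + k) n = factorAt u (j + k) n ∧ factorAt u i k = factorAt u j k := by
    intro k
    induction k with
    | zero => intro i j _ _ e; exact ⟨e, rfl⟩
    | succ k ih =>
      intro i j hi hj e
      have e' := factorAt_succ_eq_of_not_isRightSpecial (nr i hi) e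
      rw [factorAt_succ', factorAt_succ', List.cons.injEq] at e'
      obtain ⟨h1, h2⟩ := ih (i + 1) (j + 1) (by omega) (by omega) e'.2
      refine ⟨by rw [show i + (k + 1) = i + 1 + k by omega,
        show j + (k + 1) = j + 1 + k by omega, h1], ?_⟩
      rw [factorAt_succ', factorAt_succ', e'.1, h2]
  have hsub : {l : List Bool | l.length = m ∧ IsFactor u l} ⊆
      ((Finset.range q).image fun i => factorAt u i m : Finset (List Bool)) := by
    rintro l ⟨hl, hf⟩
    obtain ⟨i, rfl⟩ := hf.exists_eq hl
    simp only [Finset.coe_image, Finset.coe_range, Set.mem_image, Set.mem_Iio]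
    rcases Nat.lt_or_ge i q with hi | hi
    · exact ⟨i, hi, rfl⟩
    · obtain ⟨t, hpt, htq, e⟩ := red (i - p)
      rw [Nat.add_sub_cancel' (by omega : p ≤ i)] at e
      exact ⟨t, htq, ((next m i t (by omega) hpt e).2).symm⟩
  calc facComplexity u m ≤ _ := Set.ncard_le_ncard hsub (Finset.finite_toSet _)
    _ = _ := Set.ncard_coe_finset _
    _ ≤ (Finset.range q).card := Finset.card_image_le
    _ = q := Finset.card_range q

theorem exists_isRightSpecial {u : ℕ → Bool} (hu : ∀ q, ∃ m, q < facComplexity u m) (n : ℕ) :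
    ∃ r : List Bool, r.length = n ∧ IsRightSpecial u r := by
  by_contra hno
  push Not at hno
  obtain ⟨p, -, q, -, hpq, e⟩ := Set.infinite_univ.exists_lt_map_eq_of_mapsTo
    (f := fun i => factorAt u i n) (t := {l : List Bool | l.length = n})
    (fun i _ => length_factorAt u i n) (List.finite_length_eq Bool n)
  obtain ⟨m, hm⟩ := hu q
  exact absurd (facComplexity_le_of_window_eq hpq e
    (fun t _ _ => hno _ (length_factorAt u t n)) m) (by omega)

/-- The Morse–Hedlund lower bound. -/
theorem lt_facComplexity {u : ℕ → Bool} (hu : ∀ q, ∃ m, q < facComplexity u m) (n : ℕ) :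
    n < facComplexity u n := by
  induction n with
  | zero =>
    exact (Set.ncard_pos (finite_factors u 0)).2 ⟨_, length_factorAt u 0 0, isFactor_factorAt u 0 0⟩
  | succ n ih =>
    have : 0 < Set.ncard {r : List Bool | r.length = n ∧ IsRightSpecial u r} :=
      (Set.ncard_pos ((List.finite_length_eq Bool n).subset fun _ h => h.1)).2
        (exists_isRightSpecial hu n)
    rw [facComplexity_succ]
    omega

theorem IsPalindrome.getElem_eq {l : List α} (h : IsPalindrome l) {i j : ℕ}
    (hij : i + j + 1 = l.length) : l[i]'(by omega) = l[j]'(by omega) := by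
  have h1 : l.reverse[i]? = l[i]? := by rw [h]
  rw [List.getElem?_reverse (by omega), show l.length - 1 - i = j by omega] at h1
  simpa [List.getElem?_eq_getElem (show i < l.length by omega),
    List.getElem?_eq_getElem (show j < l.length by omega)] using h1.symm

section Sturmian

variable {u : ℕ → Bool}

theorem exists_isRightSpecial_of_sturmian (hu : ∀ n, facComplexity u n = n + 1)
    (n : ℕ) :
    ∃ r : List Bool, r.length = n ∧ IsRightSpecial u r :=
  exists_isRightSpecial (fun q => ⟨q, by rw [hu]; omega⟩) n

theorem IsRightSpecial.eq_of_sturmian (hu : ∀ n, facComplexity u n = n + 1)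
    {r r' : List Bool} (hr : IsRightSpecial u r)
    (hr' : IsRightSpecial u r') (h : r.length = r'.length) : r = r' := by
  have h1 := facComplexity_succ u r'.length
  rw [hu, hu] at h1
  obtain ⟨s, hs⟩ := Set.ncard_eq_one.1 (by omega :
    Set.ncard {r | r.length = r'.length ∧ IsRightSpecial u r} = 1)
  have e : r ∈ ({s} : Set (List Bool)) := hs ▸ ⟨h, hr⟩
  have e' : r' ∈ ({s} : Set (List Bool)) := hs ▸ ⟨rfl, hr'⟩
  exact e.trans e'.symm

theorem IsRightSpecial.exists_cons_of_sturmian (hu : ∀ n, facComplexity u n = n + 1)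
    {r : List Bool} (hr : IsRightSpecial u r) :
    ∃ c, IsRightSpecial u (c :: r) := by
  obtain ⟨s, hs, hsr⟩ := exists_isRightSpecial_of_sturmian hu (r.length + 1)
  obtain ⟨c, s', rfl⟩ := List.exists_cons_of_length_eq_add_one hs
  refine ⟨c, ?_⟩
  rwa [hr.eq_of_sturmian hu hsr.of_cons (by simpa using hs.symm)]

/-- Every factor of a Sturmian sequence extends to the left. -/
theorem IsFactor.exists_cons_of_sturmian (hu : ∀ n, facComplexity u n = n + 1)
    {l : List Bool} (hl : IsFactor u l) :
    ∃ a, IsFactor u (a :: l) := by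
  let v : ℕ → Bool := fun i => u (i + 1)
  have hv : ∀ i k, factorAt v i k = factorAt u (i + 1) k := by
    intro i k
    simp [factorAt, v, Nat.add_right_comm]
  have hsub : ∀ n, {l : List Bool | l.length = n ∧ IsFactor v l} ⊆
      {l : List Bool | l.length = n ∧ IsFactor u l} := by
    rintro n l ⟨h, h'⟩
    obtain ⟨i, rfl⟩ := h'.exists_eq h
    exact ⟨h, hv i n ▸ isFactor_factorAt u _ _⟩
  have hunb : ∀ q, ∃ m, q < facComplexity v m := by
    intro q
    refine ⟨q + 1, ?_⟩
    have hins : {l : List Bool | l.length = q + 1 ∧ IsFactor u l} ⊆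
        insert (factorAt u 0 (q + 1)) {l : List Bool | l.length = q + 1 ∧ IsFactor v l} := by
      rintro l ⟨h, h'⟩
      obtain ⟨i, rfl⟩ := h'.exists_eq h
      cases i with
      | zero => exact Or.inl rfl
      | succ i => exact Or.inr ⟨h, hv i (q + 1) ▸ isFactor_factorAt v _ _⟩
    have h1 := Set.ncard_le_ncard hins ((finite_factors v _).insert _)
    have h2 := Set.ncard_insert_le (factorAt u 0 (q + 1))
      {l : List Bool | l.length = q + 1 ∧ IsFactor v l}
    have h3 := hu (q + 1)
    unfold facComplexity at h3 ⊢
    omega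
  have heq := Set.eq_of_subset_of_ncard_le (hsub l.length)
    (by
      have h1 := lt_facComplexity hunb l.length
      have h2 := hu l.length
      unfold facComplexity at h1 h2
      omega) (finite_factors u _)
  have hlv : l ∈ {l' : List Bool | l'.length = l.length ∧ IsFactor v l'} := heq ▸ ⟨rfl, hl⟩
  obtain ⟨i, hi⟩ := hlv.2
  refine ⟨u i, ?_⟩
  rw [hi, hv, ← factorAt_succ']
  exact isFactor_factorAt u _ _

/-- A form of balance: a palindrome has at most one palindromic extension. -/
theorem palindrome_extension_unique (hu : ∀ n, facComplexity u n = n + 1)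
    {l : List Bool} (hp : IsPalindrome l)
    (h : ∀ a, IsFactor u (a :: (l ++ [a]))) : False := by
  have hr : IsRightSpecial u l := fun b => (h b).of_cons
  obtain ⟨c, hc⟩ := hr.exists_cons_of_sturmian hu
  obtain ⟨i, hi⟩ := (h (!c)).exists_eq (k := l.length + 2) (by simp)
  have hget : ∀ t (ht : t < l.length), u (i + t + 1) = l[t] := by
    intro t ht
    have h1 : (factorAt u i (l.length + 2))[t + 1]? = l[t]? := by
      rw [← hi]; simp [List.getElem?_append_left ht]
    rw [List.getElem?_eq_getElem (by rw [length_factorAt]; omega), getElem_factorAt,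
      List.getElem?_eq_getElem ht] at h1
    simpa [Nat.add_assoc] using h1
  have hlast : u (i + l.length + 1) = !c := by
    have h1 : (factorAt u i (l.length + 2))[l.length + 1]? = some (!c) := by
      rw [← hi]; simp
    rw [List.getElem?_eq_getElem (by rw [length_factorAt]; omega), getElem_factorAt] at h1
    simpa [Nat.add_assoc] using h1
  have hfirst : u i = !c := by
    rw [factorAt_succ', List.cons.injEq] at hi
    exact hi.1.symm
  have hne : ∀ t, t ≤ l.length + 1 → factorAt u (i + t) (l.length + 1) ≠ c :: l := by
    intro t ht e
    have hcl := e
    rw [factorAt_succ', List.cons.injEq] at hcl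
    have hgl : ∀ s (hs : s < l.length), u (i + t + 1 + s) = l[s] := by
      intro s hs
      have h1 : (factorAt u (i + t + 1) l.length)[s]? = l[s]? := by rw [hcl.2]
      rw [List.getElem?_eq_getElem (by rw [length_factorAt]; omega), getElem_factorAt,
        List.getElem?_eq_getElem hs] at h1
      simpa using h1
    rcases Nat.eq_zero_or_pos t with rfl | hpos
    · rw [Nat.add_zero, hfirst] at hcl
      simp at hcl
    rcases Nat.lt_or_ge l.length t with hgt | hle
    · have : i + t = i + l.length + 1 := by omega
      rw [this, hlast] at hcl
      simp at hcl
    · have h1 := hget (t - 1) (by omega)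
      have h2 := hgl (l.length - t) (by omega)
      rw [show i + (t - 1) + 1 = i + t by omega, hcl.1] at h1
      rw [show i + t + 1 + (l.length - t) = i + l.length + 1 by omega, hlast,
        hp.getElem_eq (j := t - 1) (by omega), ← h1] at h2
      simp at h2
  have hns : ∀ t, t ≤ l.length + 1 → ¬ IsRightSpecial u (factorAt u (i + t) (l.length + 1)) :=
    fun t ht hs => hne t ht (hs.eq_of_sturmian hu hc (by simp [length_factorAt]))
  let S : Set (List Bool) := {l' | l'.length = l.length + 1 ∧ IsFactor u l'} \ {c :: l}
  have hSfin : S.Finite := (finite_factors u _).sdiff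
  have hS : S.ncard = l.length + 1 := by
    have h1 : c :: l ∈ {l' : List Bool | l'.length = l.length + 1 ∧ IsFactor u l'} :=
      ⟨rfl, hc.isFactor⟩
    have h2 := Set.ncard_sdiff_singleton_of_mem h1
    have h3 := hu (l.length + 1)
    unfold facComplexity at h3
    rw [h3] at h2
    exact h2
  obtain ⟨x, hx, y, hy, hxy, e⟩ := Set.exists_ne_map_eq_of_ncard_lt_of_maps_to
    (s := ((Finset.range (l.length + 2) : Finset ℕ) : Set ℕ)) (t := S)
    (f := fun t => factorAt u (i + t) (l.length + 1))
    (by rw [hS, Set.ncard_coe_finset, Finset.card_range]; omega)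
    (by
      intro t ht
      have ht' : t < l.length + 2 := by simpa using ht
      exact ⟨⟨length_factorAt _ _ _, isFactor_factorAt _ _ _⟩, hne t (by omega)⟩) hSfin
  have hx' : x < l.length + 2 := by simpa using hx
  have hy' : y < l.length + 2 := by simpa using hy
  have key : ∀ x y, x < y → y < l.length + 2 →
      factorAt u (i + x) (l.length + 1) = factorAt u (i + y) (l.length + 1) → False := by
    intro x y hxy hy e
    have := facComplexity_le_of_window_eq (by omega : i + x < i + y) e
      (fun t h1 h2 => by
        have := hns (t - i) (by omega)
        rwa [Nat.add_sub_cancel' (by omega)] at this) (i + y)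
    rw [hu] at this
    omega
  rcases Nat.lt_or_gt_of_ne hxy with hlt | hlt
  · exact key x y hlt hy' e
  · exact key y x hlt hx' e.symm

/-- The language of a Sturmian sequence is closed under reversal. -/
theorem IsFactor.reverse_of_sturmian (hu : ∀ n, facComplexity u n = n + 1)
    {l : List Bool} (hl : IsFactor u l) :
    IsFactor u l.reverse := by
  induction hn : l.length using Nat.strong_induction_on generalizing l with
  | _ n ih =>
  rcases l with _ | ⟨a, l⟩
  · exact hl
  rcases List.eq_nil_or_concat' l with rfl | ⟨m, b, rfl⟩
  · exact hl
  simp only [List.length_cons, List.length_append, List.length_nil] at hn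
  have hbm : IsFactor u (b :: m.reverse) := by
    simpa using ih _ (by simp; omega) hl.of_cons rfl
  have hma : IsFactor u (m.reverse ++ [a]) := by
    have h1 : IsFactor u (a :: m) := by
      rw [← List.cons_append] at hl
      exact hl.of_append_singleton
    simpa using ih _ (by simp; omega) h1 rfl
  by_contra hno
  have hno' : ¬ IsFactor u (b :: (m.reverse ++ [a])) := by simpa using hno
  have h1 : IsFactor u (b :: (m.reverse ++ [!a])) := by
    obtain ⟨x, hx⟩ := hbm.exists_append_singleton
    rw [List.cons_append] at hx
    by_cases hxa : x = a
    · exact absurd (hxa ▸ hx) hno'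
    · rwa [← Bool.eq_not_of_ne hxa]
  have h2 : IsFactor u ((!b) :: (m.reverse ++ [a])) := by
    obtain ⟨x, hx⟩ := hma.exists_cons_of_sturmian hu
    by_cases hxb : x = b
    · exact absurd (hxb ▸ hx) hno'
    · rwa [← Bool.eq_not_of_ne hxb]
  have hrs : IsRightSpecial u m.reverse :=
    isRightSpecial_of_ne (by simp) hma h1.of_cons
  have h3 : IsFactor u (m ++ [!b]) := by
    rw [← List.cons_append] at h2
    simpa using ih _ (by simp; omega) h2.of_append_singleton rfl
  have hrs' : IsRightSpecial u m := isRightSpecial_of_ne (by simp) hl.of_cons h3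
  have hp : m.reverse = m := hrs.eq_of_sturmian hu hrs' (by simp)
  rw [hp] at h1 h2 hno'
  have hab : b = !a := by
    apply Bool.eq_not_of_ne
    rintro rfl
    exact hno' hl
  subst hab
  rw [Bool.not_not] at h2
  refine palindrome_extension_unique hu hp fun c => ?_
  by_cases hca : c = a
  · rwa [hca]
  · rwa [Bool.eq_not_of_ne hca]

theorem exists_palindrome_extension (hu : ∀ n, facComplexity u n = n + 1)
    {l : List Bool} (hl : IsFactor u l) (hp : IsPalindrome l) :
    ∃ c, IsFactor u (c :: (l ++ [c])) := by
  obtain ⟨b, hb⟩ := hl.exists_append_singleton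
  obtain ⟨a, ha⟩ := hb.exists_cons_of_sturmian hu
  by_cases hab : a = b
  · subst hab
    exact ⟨a, ha⟩
  have hrev : IsFactor u (b :: (l ++ [a])) := by
    have h1 := ha.reverse_of_sturmian hu
    have hp' : l.reverse = l := hp
    simpa [hp'] using h1
  obtain ⟨c, hc⟩ := (isRightSpecial_of_ne hab hrev.of_cons hb).exists_cons_of_sturmian hu
  exact ⟨c, hc c⟩

end Sturmian

/-- The word of differences (modulo 2) of consecutive letters. -/
def diffWord : List Bool → List Bool
  | [] => []
  | [_] => []
  | a :: b :: l => xor a b :: diffWord (b :: l)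

theorem length_diffWord (l : List Bool) : (diffWord l).length = l.length - 1 := by
  induction l using diffWord.induct with
  | case1 => rfl
  | case2 => rfl
  | case3 a b l ih => simp [diffWord, ih]

theorem diffWord_append (l : List Bool) (y z : Bool) :
    diffWord (l ++ [y, z]) = diffWord (l ++ [y]) ++ [xor y z] := by
  induction l using diffWord.induct with
  | case1 => rfl
  | case2 => rfl
  | case3 a b l ih => simpa [diffWord] using ih

theorem diffWord_reverse (l : List Bool) : diffWord l.reverse = (diffWord l).reverse := by
  induction l using diffWord.induct with
  | case1 => rfl
  | case2 => rfl
  | case3 a b l ih =>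
    rw [List.reverse_cons] at ih
    rw [List.reverse_cons, List.reverse_cons, List.append_assoc, List.singleton_append,
      diffWord_append, ih, diffWord, List.reverse_cons, Bool.xor_comm]

theorem diffWord_map_not (l : List Bool) : diffWord (l.map fun b => !b) = diffWord l := by
  induction l using diffWord.induct with
  | case1 => rfl
  | case2 => rfl
  | case3 a b l ih => simpa [diffWord] using ih

theorem eq_of_diffWord_eq {a : Bool} {l l' : List Bool} (hlen : l.length = l'.length)
    (h : diffWord (a :: l) = diffWord (a :: l')) : l = l' := by
  induction l generalizing a l' with
  | nil => exact (List.length_eq_zero_iff.1 hlen.symm).symm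
  | cons b l ih =>
    cases l' with
    | nil => simp at hlen
    | cons b' l' =>
      simp only [diffWord, List.cons.injEq] at h
      have hb : b = b' := by simpa using h.1
      subst hb
      rw [ih (by simpa using hlen) h.2]

theorem diffWord_factorAt (w : ℕ → Bool) (i k : ℕ) :
    diffWord (factorAt w i (k + 1)) = factorAt (fun n => xor (w n) (w (n + 1))) i k := by
  induction k generalizing i with
  | zero => rfl
  | succ k ih =>
    have h1 := ih (i + 1)
    rw [factorAt_succ'] at h1
    rw [factorAt_succ', factorAt_succ', factorAt_succ', diffWord, h1]

theorem IsPalindrome.diffWord_extension {l : List Bool} (hp : IsPalindrome l) {b : Bool}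
    {t : List Bool} (hl : l = b :: t) (c : Bool) :
    diffWord (c :: (l ++ [c])) = xor c b :: (diffWord l ++ [xor c b]) := by
  have h1 : l = t.reverse ++ [b] := by
    have h2 : l.reverse = l := hp
    rw [← h2, hl, List.reverse_cons]
  have h2 : diffWord (l ++ [c]) = diffWord l ++ [xor b c] := by
    rw [h1, List.append_assoc, List.singleton_append, diffWord_append]
  rw [Bool.xor_comm c b, ← h2, hl, List.cons_append, diffWord, Bool.xor_comm c b]

theorem IsPalindrome.exists_middle {l : List α} (hp : IsPalindrome l) {k : ℕ}
    (hl : l.length = k + 2) : ∃ c m, l = c :: (m ++ [c]) ∧ IsPalindrome m ∧ m.length = k := by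
  rcases l with _ | ⟨a, l⟩
  · simp at hl
  rcases List.eq_nil_or_concat' l with rfl | ⟨m, b, rfl⟩
  · simp at hl
  have h1 : (a :: (m ++ [b])).reverse = a :: (m ++ [b]) := hp
  simp only [List.reverse_cons, List.reverse_append, List.reverse_nil, List.nil_append,
    List.cons_append, List.cons.injEq] at h1
  obtain ⟨rfl, h1⟩ := h1
  exact ⟨b, m, rfl, List.append_cancel_right h1, by simpa using hl⟩

section Rote

variable {w : ℕ → Bool}

theorem isFactor_cons_iff_diffWord (hcs : ∀ v : List Bool, IsFactor w v → IsFactor w (v.map fun b => !b))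
    (a : Bool) (l : List Bool) :
    IsFactor w (a :: l) ↔ IsFactor (fun n => xor (w n) (w (n + 1))) (diffWord (a :: l)) := by
  constructor
  · intro h
    obtain ⟨i, hi⟩ := h.exists_eq List.length_cons
    rw [hi, diffWord_factorAt]
    exact isFactor_factorAt _ _ _
  · intro h
    obtain ⟨i, hi⟩ := h.exists_eq (k := l.length) (by simp [length_diffWord])
    rw [← diffWord_factorAt] at hi
    have hf := isFactor_factorAt w i (l.length + 1)
    rw [factorAt_succ'] at hi hf
    by_cases ha : a = w i
    · subst ha
      rwa [eq_of_diffWord_eq (by rw [length_factorAt]) hi]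
    · have hf' := hcs _ hf
      rw [← diffWord_map_not (w i :: _), List.map_cons, ← Bool.eq_not_of_ne ha] at hi
      rw [List.map_cons, ← Bool.eq_not_of_ne ha] at hf'
      rwa [eq_of_diffWord_eq (by simp [length_factorAt]) hi]

theorem facComplexity_diff (hcs : ∀ v : List Bool, IsFactor w v → IsFactor w (v.map fun b => !b))
    (hfac : ∀ k, 1 ≤ k → facComplexity w k = 2 * k) (k : ℕ) :
    facComplexity (fun n => xor (w n) (w (n + 1))) k = k + 1 := by
  let S : Bool → Set (List Bool) := fun b => {l | l.length = k ∧ IsFactor w (b :: l)}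
  have hS : ∀ b, (S b).Finite := fun b => (List.finite_length_eq Bool k).subset fun _ h => h.1
  have himg : ∀ b, {l : List Bool | l.length = k ∧
      IsFactor (fun n => xor (w n) (w (n + 1))) l} = (fun l => diffWord (b :: l)) '' S b := by
    intro b
    ext d
    constructor
    · rintro ⟨hd, h⟩
      obtain ⟨i, rfl⟩ := h.exists_eq hd
      have hf := isFactor_factorAt w i (k + 1)
      have hD := diffWord_factorAt w i k
      rw [factorAt_succ'] at hf hD
      by_cases hb : b = w i
      · subst hb
        exact ⟨_, ⟨length_factorAt _ _ _, hf⟩, hD⟩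
      · have hf' := hcs _ hf
        rw [← diffWord_map_not] at hD
        rw [List.map_cons, ← Bool.eq_not_of_ne hb] at hf' hD
        exact ⟨_, ⟨by simp [length_factorAt], hf'⟩, hD⟩
    · rintro ⟨l, ⟨hl, h⟩, rfl⟩
      exact ⟨by simp [length_diffWord, hl], (isFactor_cons_iff_diffWord hcs b l).1 h⟩
  have hcard : ∀ b, (S b).ncard = facComplexity (fun n => xor (w n) (w (n + 1))) k := by
    intro b
    unfold facComplexity
    rw [himg b, Set.InjOn.ncard_image]
    intro l hl l' hl' e
    exact eq_of_diffWord_eq (hl.1.trans hl'.1.symm) e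
  have hunion : {l : List Bool | l.length = k + 1 ∧ IsFactor w l} =
      List.cons true '' S true ∪ List.cons false '' S false := by
    ext l
    constructor
    · rintro ⟨hl, h⟩
      obtain ⟨b, l, rfl⟩ := List.exists_cons_of_length_eq_add_one hl
      have hl' : l.length = k := by simpa using hl
      cases b
      · exact Or.inr ⟨l, ⟨hl', h⟩, rfl⟩
      · exact Or.inl ⟨l, ⟨hl', h⟩, rfl⟩
    · rintro (⟨l, ⟨hl, h⟩, rfl⟩ | ⟨l, ⟨hl, h⟩, rfl⟩) <;> exact ⟨by simpa using hl, h⟩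
  have htot := hfac (k + 1) (by omega)
  unfold facComplexity at htot
  rw [hunion, Set.ncard_union_eq _ ((hS _).image _) ((hS _).image _),
    Set.ncard_image_of_injective _ List.cons_injective,
    Set.ncard_image_of_injective _ List.cons_injective, hcard, hcard] at htot
  · omega
  · rw [Set.disjoint_left]
    rintro _ ⟨l, -, rfl⟩ ⟨l', -, h⟩
    simp at h

theorem palComplexity_add_two (hcs : ∀ v : List Bool, IsFactor w v → IsFactor w (v.map fun b => !b))
    (hfac : ∀ k, 1 ≤ k → facComplexity w k = 2 * k) {k : ℕ}
    (hk : 1 ≤ k) : palComplexity w (k + 2) = palComplexity w k := by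
  have hv := facComplexity_diff hcs hfac
  have hpd : ∀ l, IsPalindrome l → IsPalindrome (diffWord l) := by
    intro l hl
    have hl' : l.reverse = l := hl
    unfold IsPalindrome
    rw [← diffWord_reverse, hl']
  have himg : {l : List Bool | l.length = k ∧ IsFactor w l ∧ IsPalindrome l} =
      (fun l => l.tail.dropLast) ''
        {l : List Bool | l.length = k + 2 ∧ IsFactor w l ∧ IsPalindrome l} := by
    ext l
    constructor
    · rintro ⟨hl, hf, hp⟩
      obtain ⟨b, t, ht⟩ := List.exists_cons_of_length_pos (by omega : 0 < l.length)
      have hd : IsFactor (fun n => xor (w n) (w (n + 1))) (diffWord l) := by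
        rw [ht] at hf ⊢
        exact (isFactor_cons_iff_diffWord hcs b t).1 hf
      obtain ⟨x, hx⟩ := exists_palindrome_extension hv hd (hpd l hp)
      refine ⟨xor x b :: (l ++ [xor x b]), ⟨by simp [hl], ?_, ?_⟩, by simp⟩
      · rw [isFactor_cons_iff_diffWord hcs, hp.diffWord_extension ht]
        simpa using hx
      · have hp' : l.reverse = l := hp
        simp [IsPalindrome, hp']
    · rintro ⟨l, ⟨hl, hf, hp⟩, rfl⟩
      obtain ⟨c, m, rfl, hm, hmk⟩ := hp.exists_middle hl
      simpa using And.intro hmk (And.intro hf.of_cons.of_append_singleton hm)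
  unfold palComplexity
  rw [himg, Set.InjOn.ncard_image]
  rintro _ ⟨hl, hf, hp⟩ _ ⟨hl', hf', hp'⟩ e
  obtain ⟨c, m, rfl, hm, hmk⟩ := hp.exists_middle hl
  obtain ⟨c', m', rfl, -, -⟩ := hp'.exists_middle hl'
  have hmm : m = m' := by simpa using e
  subst hmm
  by_contra hne
  have hcc : c' ≠ c := by
    rintro rfl
    exact hne rfl
  obtain ⟨b, t, ht⟩ := List.exists_cons_of_length_pos (by omega : 0 < m.length)
  rw [isFactor_cons_iff_diffWord hcs, hm.diffWord_extension ht] at hf hf'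
  refine palindrome_extension_unique hv (hpd m hm) fun x => ?_
  by_cases hx : x = xor c b
  · rwa [hx]
  · have : x = xor c' b := by
      revert hx hcc
      cases x <;> cases c <;> cases c' <;> cases b <;> decide
    rwa [this]

end Rote

/-- A complementation-symmetric (Rote) sequence on a two-letter alphabet with
block complexity `2k` has palindrome complexity constantly `2`. -/
theorem stmt8 (w : ℕ → Bool)
    (hcs : ∀ v : List Bool, IsFactor w v → IsFactor w (v.map fun b => !b))
    (hfac : ∀ k, 1 ≤ k → facComplexity w k = 2 * k) :
    ∀ k, 1 ≤ k → palComplexity w k = 2 := by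
  have h1 : palComplexity w 1 = 2 := by
    refine Eq.trans ?_ (hfac 1 le_rfl)
    unfold palComplexity facComplexity
    congr 1
    ext l
    constructor
    · exact fun h => ⟨h.1, h.2.1⟩
    · rintro ⟨hl, h⟩
      obtain ⟨a, rfl⟩ := List.length_eq_one_iff.1 hl
      exact ⟨hl, h, rfl⟩
  have h2 : palComplexity w 2 = 2 := by
    have hv := facComplexity_diff hcs hfac
    have hnil : IsRightSpecial (fun n => xor (w n) (w (n + 1))) [] := by
      obtain ⟨r, hr, h⟩ := exists_isRightSpecial_of_sturmian hv 0
      rwa [List.length_eq_zero_iff.1 hr] at h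
    have hset : {l : List Bool | l.length = 2 ∧ IsFactor w l ∧ IsPalindrome l} =
        {[true, true], [false, false]} := by
      ext l
      constructor
      · rintro ⟨hl, -, hp⟩
        obtain ⟨c, m, rfl, -, hm⟩ := hp.exists_middle hl
        rw [List.length_eq_zero_iff.1 hm]
        cases c <;> simp
      · rintro (rfl | rfl) <;>
          exact ⟨rfl, (isFactor_cons_iff_diffWord hcs _ _).2 (hnil false), rfl⟩
    unfold palComplexity
    rw [hset]
    exact Set.ncard_pair (by decide)
  intro k
  induction k using Nat.strong_induction_on with
  | _ k ih =>
    intro hk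
    rcases k with _ | _ | _ | k
    · omega
    · exact h1
    · exact h2
    · rw [palComplexity_add_two hcs hfac (by omega)]
      exact ih (k + 1) (by omega) (by omega)

end PalPaper
end

section
/- Let σ be a primitive morphism on a finite alphabet A and let u be an infinite sequence with σ(u) = u. Assume: (i) there is a palindrome p and, for every a ∈ A, a palindrome q_a, with σ(a) = p q_a for all a; (ii) all the q_a have the same length l_q, so σ has constant length d = l_p + l_q where l_p = |p|; (iii) for a ≠ b, the words q_a and q_b have distinct first letters. Then the sequence (pal_u(k))_{k ≥ 1} of palindrome complexities is d-automatic. -/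
namespace PalPaper

variable {α : Type*}

/-- A sequence `f : ℕ → ℕ` is `d`-automatic: it is the letterwise image of a
fixed point of a `d`-uniform morphism on a finite alphabet. -/
def IsAutomaticSeq (d : ℕ) (f : ℕ → ℕ) : Prop :=
  ∃ (B : Type) (_ : Fintype B) (τ : B → List B) (w : ℕ → B) (g : B → ℕ),
    (∀ b, (τ b).length = d) ∧ IsFixedPointOf τ w ∧ ∀ n, f n = g (w n)

/-- The block of length `k` of `u` starting at `i` reads the same backwards. -/
def PalAt (u : ℕ → α) (i k : ℕ) : Prop :=
  ∀ x y, i ≤ x → i ≤ y → x + y + 1 = 2 * i + k → u x = u y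

/-- The combinatorial content of being fixed by `a ↦ p ++ q a`, read off the positions of `u`:
`p` and all `q a` are palindromes of lengths `lp` and `lq`, and `q a` determines `a` through its
first letter. -/
structure IsClassPSeq (u : ℕ → α) (lp lq : ℕ) : Prop where
  lq_pos : 0 < lq
  prefix_pal : ∀ n n' j, j < lp →
    u ((lp + lq) * n + j) = u ((lp + lq) * n' + (lp - 1 - j))
  tail_pal : ∀ n n' j, j < lq → u n = u n' →
    u ((lp + lq) * n + lp + j) = u ((lp + lq) * n' + lp + (lq - 1 - j))
  tail_inj : ∀ n n', u ((lp + lq) * n + lp) = u ((lp + lq) * n' + lp) → u n = u n'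

section Words

lemma factorAt_length (u : ℕ → α) (i k : ℕ) : (factorAt u i k).length = k := by
  simp [factorAt]

lemma factorAt_eq_iff (u : ℕ → α) (i j k : ℕ) :
    factorAt u i k = factorAt u j k ↔ ∀ x < k, u (i + x) = u (j + x) := by
  simp [factorAt, List.map_inj_left]

lemma isPalindrome_factorAt_iff (u : ℕ → α) (i k : ℕ) :
    IsPalindrome (factorAt u i k) ↔ PalAt u i k := by
  have h : IsPalindrome (factorAt u i k) ↔ ∀ x < k, u (i + (k - 1 - x)) = u (i + x) := by
    unfold IsPalindrome
    constructor
    · intro h x hx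
      have := congrArg (fun l => l[x]?) h
      simpa [factorAt, List.getElem?_reverse, hx, show k - 1 - x < k by omega] using this
    · intro h
      apply List.ext_getElem
      · simp
      · intro x h1 h2
        have hx : x < k := by simpa [factorAt] using h2
        simpa [factorAt, List.getElem_reverse] using h x hx
  rw [h]
  constructor
  · intro h x y hx hy hxy
    have := h (y - i) (by omega)
    rwa [show i + (k - 1 - (y - i)) = x by omega, show i + (y - i) = y by omega] at this
  · intro h x hx
    exact h _ _ (by omega) (by omega) (by omega)

lemma palComplexity_eq (u : ℕ → α) (k : ℕ) :
    palComplexity u k = ((fun i => factorAt u i k) '' {i | PalAt u i k}).ncard := by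
  unfold palComplexity
  congr 1
  ext w
  constructor
  · rintro ⟨rfl, ⟨i, hi⟩, hw⟩
    refine ⟨i, ?_, hi.symm⟩
    rw [hi] at hw
    exact (isPalindrome_factorAt_iff _ _ _).1 hw
  · rintro ⟨i, hi, rfl⟩
    exact ⟨factorAt_length _ _ _, ⟨i, by rw [factorAt_length]⟩,
      (isPalindrome_factorAt_iff _ _ _).2 hi⟩

lemma ncard_image_eq_ncard_image {ι κ β γ : Type*} {f : ι → β} {g : κ → γ} {S : Set ι}
    {T : Set κ} (φ : ι → κ) (hφ : φ '' S = T)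
    (h : ∀ x ∈ S, ∀ y ∈ S, f x = f y ↔ g (φ x) = g (φ y)) :
    (f '' S).ncard = (g '' T).ncard := by
  classical
  rcases S.eq_empty_or_nonempty with rfl | ⟨x₀, -⟩
  · simp [← hφ]
  have : Nonempty ι := ⟨x₀⟩
  have key : ∀ x ∈ S, g (φ (Function.invFunOn f S (f x))) = g (φ x) := fun x hx =>
    (h _ (Function.invFunOn_mem ⟨x, hx, rfl⟩) _ hx).1 (Function.invFunOn_eq ⟨x, hx, rfl⟩)
  have him : g '' T = (fun b => g (φ (Function.invFunOn f S b))) '' (f '' S) := by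
    rw [← hφ, Set.image_image, Set.image_image]
    exact Set.image_congr fun x hx => (key x hx).symm
  rw [him]
  refine (Set.InjOn.ncard_image ?_).symm
  rintro _ ⟨x, hx, rfl⟩ _ ⟨y, hy, rfl⟩ hxy
  simp only [key x hx, key y hy] at hxy
  exact (h x hx y hy).2 hxy

end Words

section Uniform

lemma seqPrefix_add (u : ℕ → α) (a b : ℕ) :
    seqPrefix u (a + b) = seqPrefix u a ++ factorAt u a b := by
  simp [seqPrefix, factorAt, List.range_add, Function.comp_def]

lemma substPrefix_succ (σ : α → List α) (u : ℕ → α) (n : ℕ) :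
    substPrefix σ u (n + 1) = substPrefix σ u n ++ σ (u n) := by
  simp [substPrefix, List.range_succ]

lemma isFixedPointOf_iff_of_uniform {σ : α → List α} {d : ℕ} (hd : ∀ a, (σ a).length = d)
    (u : ℕ → α) : IsFixedPointOf σ u ↔ ∀ n, σ (u n) = factorAt u (d * n) d := by
  have hlen : ∀ n, (substPrefix σ u n).length = d * n := by
    intro n
    induction n with
    | zero => simp [substPrefix]
    | succ n ih => rw [substPrefix_succ, List.length_append, ih, hd]; ring
  unfold IsFixedPointOf IsMorphicImage
  simp only [hlen]
  constructor
  · intro h n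
    have h1 := h (n + 1)
    rw [substPrefix_succ, mul_add, mul_one, seqPrefix_add, h n] at h1
    exact List.append_cancel_left h1
  · intro h n
    induction n with
    | zero => simp [substPrefix, seqPrefix]
    | succ n ih => rw [substPrefix_succ, mul_add, mul_one, seqPrefix_add, ih, h n]

lemma exists_eq_of_mem_morphIter {σ : α → List α} {d : ℕ} {u : ℕ → α}
    (h : ∀ n, σ (u n) = factorAt u (d * n) d) (k n : ℕ) {b : α}
    (hb : b ∈ morphIter σ k (u n)) : ∃ r < d ^ k, u (d ^ k * n + r) = b := by
  induction k generalizing n with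
  | zero => exact ⟨0, by simp, by simpa [morphIter, eq_comm] using hb⟩
  | succ k ih =>
    rw [morphIter, List.mem_flatMap] at hb
    obtain ⟨c, hc, hb⟩ := hb
    rw [h, factorAt, List.mem_map] at hc
    obtain ⟨j, hj, rfl⟩ := hc
    rw [List.mem_range] at hj
    obtain ⟨r, hr, hu⟩ := ih _ hb
    refine ⟨d ^ k * j + r, ?_, ?_⟩
    · calc d ^ k * j + r < d ^ k * (j + 1) := by rw [mul_add]; omega
        _ ≤ d ^ (k + 1) := by rw [pow_succ]; exact Nat.mul_le_mul_left _ hj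
    · rw [← hu]; congr 1; ring

lemma pow_block_congr {u : ℕ → α} {d : ℕ}
    (h : ∀ n n' j, u n = u n' → j < d → u (d * n + j) = u (d * n' + j))
    (e n n' r : ℕ) (hn : u n = u n') (hr : r < d ^ e) :
    u (d ^ e * n + r) = u (d ^ e * n' + r) := by
  induction e generalizing r with
  | zero =>
    obtain rfl : r = 0 := by simpa using hr
    simpa using hn
  | succ e ih =>
    have hd : 0 < d := by
      rcases Nat.eq_zero_or_pos d with rfl | hd
      · simp at hr
      · exact hd
    have key := h _ _ (r % d) (ih (r / d)
      (Nat.div_lt_of_lt_mul (by rwa [pow_succ, mul_comm] at hr))) (Nat.mod_lt _ hd)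
    have e1 : ∀ m, d * (d ^ e * m + r / d) + r % d = d ^ (e + 1) * m + r := by
      intro m
      conv_rhs => rw [← Nat.div_add_mod r d]
      ring
    rwa [e1, e1] at key

lemma exists_recurrence_bound {u : ℕ → α} {d k : ℕ} (hd : 2 ≤ d)
    (h : ∀ n n' j, u n = u n' → j < d → u (d * n + j) = u (d * n' + j))
    (hrec : ∀ n b, ∃ r < d ^ k, u (d ^ k * n + r) = b) (s : ℕ) :
    ∃ D, ∀ n, ∃ j < D, u (n + j) = u s ∧ u (n + j + 1) = u (s + 1) := by
  obtain ⟨e, he⟩ : ∃ e, s + 1 < d ^ e := ⟨s + 1, Nat.lt_pow_self (by omega)⟩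
  refine ⟨2 * (d ^ e * d ^ k), fun n => ?_⟩
  set E := d ^ e * d ^ k with hE
  have hEpos : 0 < E := by positivity
  obtain ⟨r, hr, hu⟩ := hrec (n / E + 1) (u 0)
  have h1 := pow_block_congr h e _ _ s hu (by omega)
  have h2 := pow_block_congr h e _ _ (s + 1) hu he
  have e1 : d ^ e * (d ^ k * (n / E + 1) + r) = E * (n / E) + E + d ^ e * r := by
    rw [hE]; ring
  have e2 := Nat.div_add_mod n E
  have e3 := Nat.mod_lt n hEpos
  have e4 : d ^ e * r + d ^ e ≤ E := by
    rw [hE, ← Nat.mul_succ]; exact Nat.mul_le_mul_left _ hr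
  rw [e1] at h1 h2
  simp only [mul_zero, zero_add] at h1 h2
  refine ⟨E * (n / E) + E + d ^ e * r + s - n, by omega, ?_, ?_⟩
  · rw [← h1]; congr 1; omega
  · rw [← h2]; congr 1; omega

end Uniform

section Automatic

lemma isAutomaticSeq_of_congr {X : Type} {d : ℕ} (w : ℕ → X) (hfin : (Set.range w).Finite)
    (hw : ∀ n n', w n = w n' → ∀ r < d, w (d * n + r) = w (d * n' + r))
    (f : ℕ → ℕ) (hf : ∀ n n', w n = w n' → f n = f n') : IsAutomaticSeq d f := by
  classical
  have : Fintype (Set.range w) := hfin.fintype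
  let v : ℕ → Set.range w := fun n => ⟨w n, n, rfl⟩
  let c : Set.range w → ℕ := fun b => b.2.choose
  have hc : ∀ n, w (c (v n)) = w n := fun n => (v n).2.choose_spec
  have hlen : ∀ b, (factorAt v (d * c b) d).length = d := fun b => factorAt_length _ _ _
  refine ⟨Set.range w, inferInstance, fun b => factorAt v (d * c b) d, v, fun b => f (c b),
    hlen, (isFixedPointOf_iff_of_uniform hlen v).2 fun n => ?_, fun n => (hf _ _ (hc n)).symm⟩
  rw [factorAt_eq_iff]
  exact fun r hr => Subtype.ext (hw _ _ (hc n) r hr)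

lemma isAutomaticSeq_of_transfer {d : ℕ} (hd : 0 < d) (P : ℕ → ℕ) (N : ℕ)
    (hfin : (Set.range P).Finite)
    (htr : ∀ n n', N ≤ n → N ≤ n' → n % 2 = n' % 2 → (∀ j < 6, P (n + j) = P (n' + j)) →
      ∀ r < d + 5, P (d * n + r) = P (d * n' + r)) :
    IsAutomaticSeq d (fun k => P (k + 1)) := by
  let w : ℕ → ℕ × ℕ × (Fin 6 → ℕ) := fun n => (min n N, n % 2, fun j => P (n + j))
  have hw : ∀ n n', w n = w n' ↔
      min n N = min n' N ∧ n % 2 = n' % 2 ∧ ∀ j < 6, P (n + j) = P (n' + j) := by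
    intro n n'
    simp [w, funext_iff, Fin.forall_iff]
  refine isAutomaticSeq_of_congr w ?_ ?_ _ ?_
  · refine ((Set.finite_Iic N).prod ((Set.finite_Iic 1).prod
      (Set.Finite.pi (ι := Fin 6) fun _ => hfin))).subset ?_
    rintro _ ⟨n, rfl⟩
    refine ⟨?_, ?_, fun j _ => ⟨_, rfl⟩⟩
    · simp [w]
    · simp only [w, Set.mem_Iic]; omega
  · intro n n' h r hr
    rw [hw] at h ⊢
    obtain ⟨h1, h2, h3⟩ := h
    by_cases hn : n < N
    · obtain rfl : n = n' := by omega
      exact ⟨rfl, rfl, fun _ _ => rfl⟩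
    · have a1 := Nat.le_mul_of_pos_left n hd
      have a2 := Nat.le_mul_of_pos_left n' hd
      refine ⟨by omega, ?_, fun j hj => ?_⟩
      · simp [Nat.add_mod, Nat.mul_mod, h2]
      · have := htr n n' (by omega) (by omega) h2 h3 (r + j) (by omega)
        simpa only [add_assoc] using this
  · intro n n' h
    exact ((hw _ _).1 h).2.2 1 (by norm_num)

end Automatic

section Deterministic

/-- If equal letters have equal neighbours, long palindromes exist only in period two. -/
lemma palComplexity_congr_of_deterministic {u : ℕ → α}
    (hpred : ∀ s t, u (s + 1) = u (t + 1) → u s = u t)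
    (hsucc : ∀ s t, u s = u t → u (s + 1) = u (t + 1)) {k k' : ℕ} (hk : 2 ≤ k) (hk' : 2 ≤ k')
    (hkk : k % 2 = k' % 2) : palComplexity u k = palComplexity u k' := by
  have hpred' : ∀ n s t, u (s + n) = u (t + n) → u s = u t := by
    intro n
    induction n with
    | zero => exact fun s t h => h
    | succ n ih => exact fun s t h => ih s t (hpred _ _ h)
  have hsucc' : ∀ n s t, u s = u t → u (s + n) = u (t + n) := by
    intro n
    induction n with
    | zero => exact fun s t h => h
    | succ n ih => exact fun s t h => hsucc _ _ (ih s t h)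
  have hper : ∀ i k, 2 ≤ k → PalAt u i k → ∀ n, u n = u (n + 2) := by
    intro i k hk h n
    obtain ⟨c, hc⟩ : ∃ c, u c = u (c + 2) := by
      rcases Nat.even_or_odd' k with ⟨t, rfl | rfl⟩
      · have h1 := h (i + t - 1) (i + t - 1 + 1) (by omega) (by omega) (by omega)
        exact ⟨_, h1.trans (hsucc _ _ h1)⟩
      · exact ⟨i + t - 1, h _ _ (by omega) (by omega) (by omega)⟩
    have h1 := hsucc' n _ _ hc
    refine hpred' c _ _ ?_
    rwa [add_comm n c, show n + 2 + c = c + 2 + n by ring]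
  have htrans : ∀ i k k', 2 ≤ k → 2 ≤ k' → k % 2 = k' % 2 → PalAt u i k → PalAt u i k' := by
    intro i k k' hk hk' hkk h x y hx hy hxy
    have hp := hper i k hk h
    have hmul : ∀ c n, u n = u (n + 2 * c) := by
      intro c
      induction c with
      | zero => exact fun n => rfl
      | succ c ih => exact fun n => (ih n).trans (hp _)
    have hpar : ∀ a b, a % 2 = b % 2 → u a = u b := by
      intro a b hab
      rcases le_total a b with hle | hle
      · rw [hmul ((b - a) / 2) a]; congr 1; omega
      · rw [hmul ((a - b) / 2) b]; congr 1; omega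
    rw [hpar x (i + (x - i) % 2) (by omega), hpar y (i + k - 1 - (x - i) % 2) (by omega)]
    exact h _ _ (by omega) (by omega) (by omega)
  rw [palComplexity_eq, palComplexity_eq]
  refine ncard_image_eq_ncard_image id ?_ ?_
  · rw [Set.image_id]
    ext i
    exact ⟨htrans i k k' hk hk' hkk, htrans i k' k hk' hk hkk.symm⟩
  · have hfac : ∀ k, 2 ≤ k → ∀ i j, factorAt u i k = factorAt u j k ↔ u i = u j := by
      intro k hk i j
      rw [factorAt_eq_iff]
      exact ⟨fun h => h 0 (by omega), fun h x _ => hsucc' x _ _ h⟩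
    intro i _ j _
    exact (hfac k hk i j).trans (hfac k' hk' i j).symm

end Deterministic

namespace IsClassPSeq

variable {u : ℕ → α} {lp lq : ℕ}

lemma prefix_const (h : IsClassPSeq u lp lq) (n n' : ℕ) {j : ℕ} (hj : j < lp) :
    u ((lp + lq) * n + j) = u ((lp + lq) * n' + j) := by
  rw [h.prefix_pal n n j hj, h.prefix_pal n n' (lp - 1 - j) (by omega)]
  congr 2; omega

lemma block_congr (h : IsClassPSeq u lp lq) {n n' j : ℕ} (hn : u n = u n')
    (hj : j < lp + lq + lp) : u ((lp + lq) * n + j) = u ((lp + lq) * n' + j) := by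
  rcases lt_or_ge j lp with h1 | h1
  · exact h.prefix_const n n' h1
  rcases lt_or_ge j (lp + lq) with h2 | h2
  · obtain ⟨j, rfl⟩ := Nat.exists_eq_add_of_le h1
    rw [← add_assoc, ← add_assoc, h.tail_pal n n j (by omega) rfl,
      h.tail_pal n n' (lq - 1 - j) (by omega) hn]
    congr 2; omega
  · obtain ⟨j, rfl⟩ := Nat.exists_eq_add_of_le h2
    have := h.prefix_const (n + 1) (n' + 1) (j := j) (by omega)
    simpa only [mul_add, mul_one, add_assoc] using this

lemma eq_of_first_eq_last (h : IsClassPSeq u lp lq) {n n' : ℕ}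
    (hn : u ((lp + lq) * n + (lp + lq - 1)) = u ((lp + lq) * n' + lp)) : u n = u n' := by
  have hq := h.lq_pos
  refine h.tail_inj _ _ (Eq.trans ?_ hn)
  have := h.tail_pal n n 0 hq rfl
  rw [add_zero] at this
  rw [this]; congr 1; omega

lemma eq_of_last_eq (h : IsClassPSeq u lp lq) {n n' : ℕ}
    (hn : u ((lp + lq) * n + (lp + lq - 1)) = u ((lp + lq) * n' + (lp + lq - 1))) :
    u n = u n' := by
  have hq := h.lq_pos
  refine h.eq_of_first_eq_last (hn.trans ?_)
  have := h.tail_pal n' n' 0 hq rfl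
  rw [add_zero] at this
  rw [this]; congr 1; omega

/-- In a sequence that is not left deterministic, long palindromes are centred at the centre of a
block `p` or `q a`. -/
lemma exists_center_bound (h : IsClassPSeq u lp lq) {s t : ℕ} (hst : u s ≠ u t)
    (hst' : u (s + 1) = u (t + 1))
    (hrec : ∀ s, ∃ D, ∀ n, ∃ j < D, u (n + j) = u s ∧ u (n + j + 1) = u (s + 1)) :
    ∃ L, ∀ i k, L ≤ k → PalAt u i k → 2 * i + k ≡ lp [MOD lp + lq] := by
  obtain ⟨D₁, hD₁⟩ := hrec s
  obtain ⟨D₂, hD₂⟩ := hrec t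
  have hlq := h.lq_pos
  set d := lp + lq with hd
  refine ⟨d * (D₁ + D₂ + 4), fun i k hk hpal => ?_⟩
  obtain ⟨a, ha, ha0, ha1⟩ := hD₁ (i / d + 1)
  obtain ⟨b, hb, hb0, hb1⟩ := hD₂ (i / d + 1)
  set s' := i / d + 1 + a with hs'
  set t' := i / d + 1 + b with ht'
  have hi := Nat.div_add_mod i d
  have hi' := Nat.mod_lt i (show 0 < d by omega)
  have bound : ∀ c, c < D₁ + D₂ → i < d * (i / d + 1 + c) ∧
      d * (i / d + 1 + c) + 3 * d ≤ i + k := by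
    intro c hc
    have e1 : d * (i / d + 1 + c) = d * (i / d) + d + d * c := by ring
    have e2 : d * (c + 1) ≤ d * (D₁ + D₂) := Nat.mul_le_mul_left _ hc
    have e3 : d * (D₁ + D₂ + 4) = d * (D₁ + D₂) + 4 * d := by ring
    have e4 : d * (c + 1) = d * c + d := by ring
    omega
  obtain ⟨hs1, hs2⟩ := bound a (by omega)
  obtain ⟨ht1, ht2⟩ := bound b (by omega)
  rw [← hs'] at hs1 hs2
  rw [← ht'] at ht1 ht2
  clear_value s' t'
  clear hi hi' bound hD₁ hD₂ hrec hk ha hb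
  obtain ⟨y₁, hy₁⟩ : ∃ y, y + lp + (d * s' + d) + 1 = 2 * i + k :=
    ⟨2 * i + k - 1 - (d * s' + d) - lp, by omega⟩
  obtain ⟨y₂, hy₂⟩ : ∃ y, y + lp + (d * t' + d) + 1 = 2 * i + k :=
    ⟨2 * i + k - 1 - (d * t' + d) - lp, by omega⟩
  have hyy : y₂ % d = y₁ % d := by
    rw [← Nat.add_mul_mod_self_left y₁ d s', ← Nat.add_mul_mod_self_left y₂ d t']
    congr 1; omega
  obtain ⟨e, m₁, m₂, hed, q1, q2⟩ :
      ∃ e m₁ m₂, e < d ∧ d * m₁ + e = y₁ ∧ d * m₂ + e = y₂ :=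
    ⟨y₁ % d, y₁ / d, y₂ / d, Nat.mod_lt _ (by omega), Nat.div_add_mod _ _, by
      rw [← hyy]; exact Nat.div_add_mod _ _⟩
  clear hyy
  subst q1 q2
  have hm : u m₁ = u m₂ := by
    apply h.tail_inj
    rw [← hd, hpal (d * m₁ + lp) (d * (s' + 1) + e) (by omega) (by rw [mul_add]; omega)
        (by rw [mul_add]; omega),
      hpal (d * m₂ + lp) (d * (t' + 1) + e) (by omega) (by rw [mul_add]; omega)
        (by rw [mul_add]; omega)]
    exact h.block_congr (by rw [ha1, hb1, hst']) (by omega)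
  rcases Nat.lt_or_ge (e + 1) d with hlt | hge
  · exfalso
    apply hst
    rw [← ha0, ← hb0]
    apply h.eq_of_last_eq
    rw [← hd, hpal (d * s' + (d - 1)) (d * m₁ + (lp + e + 1)) (by omega) (by omega) (by omega),
      hpal (d * t' + (d - 1)) (d * m₂ + (lp + e + 1)) (by omega) (by omega) (by omega)]
    exact h.block_congr hm (by omega)
  · have : 2 * i + k = lp + d * (m₁ + s' + 2) := by
      have : d * (m₁ + s' + 2) = d * m₁ + d * s' + 2 * d := by ring
      omega
    rw [this]
    simp [Nat.ModEq]

lemma palAt_image (h : IsClassPSeq u lp lq) {n m : ℕ} (hpal : PalAt u n m) :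
    PalAt u ((lp + lq) * n) ((lp + lq) * m + lp) := by
  have hlq := h.lq_pos
  set d := lp + lq with hd
  intro x y hx hy hxy
  have hx1 := Nat.div_add_mod x d
  have hy1 := Nat.div_add_mod y d
  have hx2 := Nat.mod_lt x (show 0 < d by omega)
  have hy2 := Nat.mod_lt y (show 0 < d by omega)
  set a := x / d
  set b := y / d
  have han : n ≤ a := (Nat.le_div_iff_mul_le (by omega)).2 (by rwa [mul_comm])
  have hbn : n ≤ b := (Nat.le_div_iff_mul_le (by omega)).2 (by rwa [mul_comm])
  have hsum : d * (a + b) + x % d + y % d + 1 = d * (2 * n + m) + lp := by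
    have e1 : d * (a + b) = d * a + d * b := by ring
    have e2 : d * (2 * n + m) = 2 * (d * n) + d * m := by ring
    omega
  rcases lt_or_ge (x % d) lp with hc | hc
  · have : y % d = lp - 1 - x % d := by
      have hab : a + b = 2 * n + m := by
        rcases lt_trichotomy (a + b) (2 * n + m) with hl | hl | hl
        · have := Nat.mul_le_mul_left d hl
          rw [Nat.succ_eq_add_one, mul_add, mul_one] at this
          omega
        · exact hl
        · have := Nat.mul_le_mul_left d hl
          rw [Nat.succ_eq_add_one, mul_add, mul_one] at this
          omega
      rw [hab] at hsum
      omega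
    rw [← hx1, ← hy1, this]
    exact h.prefix_pal _ _ _ hc
  · have hab : a + b + 1 = 2 * n + m := by
      rcases lt_trichotomy (a + b + 1) (2 * n + m) with hl | hl | hl
      · have := Nat.mul_le_mul_left d hl
        rw [Nat.succ_eq_add_one, mul_add, mul_add, mul_one] at this
        omega
      · exact hl
      · have := Nat.mul_le_mul_left d (Nat.le_of_lt_succ hl)
        omega
    have hy3 : y % d = lp + (lq - 1 - (x % d - lp)) := by
      rw [← hab, mul_add d (a + b), mul_one] at hsum
      omega
    have hx3 : x % d = lp + (x % d - lp) := by omega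
    rw [← hx1, ← hy1, hy3, hx3, ← add_assoc, ← add_assoc,
      show lp + (x % d - lp) - lp = x % d - lp by omega]
    exact h.tail_pal _ _ _ (by omega) (hpal a b han hbn hab)

lemma palAt_of_image (h : IsClassPSeq u lp lq) {n m k t : ℕ} (hm : 2 ≤ m) (ht : t < lp + lq)
    (hk : k + 2 * t = (lp + lq) * m + lp) (hpal : PalAt u ((lp + lq) * n + t) k) :
    PalAt u n m := by
  have hlq := h.lq_pos
  set d := lp + lq with hd
  have main : ∀ x y, n ≤ x → n < y → x + y + 1 = 2 * n + m → u x = u y := by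
    intro x y hx hy hxy
    apply h.eq_of_first_eq_last
    have e1 : d * n ≤ d * x := Nat.mul_le_mul_left _ hx
    have e2 : d * (n + 1) ≤ d * y := Nat.mul_le_mul_left _ hy
    have e3 : d * (x + y + 1) = d * (2 * n + m) := by rw [hxy]
    have e4 : d * (n + 1) = d * n + d := by ring
    have e5 : d * (x + y + 1) = d * x + d * y + d := by ring
    have e6 : d * (2 * n + m) = 2 * (d * n) + d * m := by ring
    rw [← hd]
    exact hpal _ _ (by omega) (by omega) (by omega)
  intro x y hx hy hxy
  rcases hy.lt_or_eq with hy | hy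
  · exact main x y hx hy hxy
  · exact (main y x (by omega) (by omega) (by omega)).symm

lemma factorAt_image_eq_iff (h : IsClassPSeq u lp lq) {n n' m k t : ℕ} (hm : 2 ≤ m)
    (ht : t < lp + lq) (hk : k + 2 * t = (lp + lq) * m + lp) :
    factorAt u n m = factorAt u n' m ↔
      factorAt u ((lp + lq) * n + t) k = factorAt u ((lp + lq) * n' + t) k := by
  have hlq := h.lq_pos
  set d := lp + lq with hd
  rw [factorAt_eq_iff, factorAt_eq_iff]
  constructor
  · intro H y hy
    have h1 := Nat.div_add_mod (t + y) d
    have h2 := Nat.mod_lt (t + y) (show 0 < d by omega)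
    set a := (t + y) / d
    have e : ∀ n, d * n + t + y = d * (n + a) + (t + y) % d := by
      intro n; rw [mul_add]; omega
    rw [e, e]
    rcases lt_or_ge a m with hc | hc
    · exact h.block_congr (H a hc) (by omega)
    · have := Nat.mul_le_mul_left d hc
      exact h.prefix_const _ _ (by omega)
  · intro H x hx
    rcases Nat.eq_zero_or_pos x with rfl | hx0
    · have e1 : d * 2 ≤ d * m := Nat.mul_le_mul_left _ hm
      have := H (d - 1 - t) (by omega)
      apply h.eq_of_last_eq
      rw [add_zero, add_zero, ← hd]
      convert this using 2 <;> omega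
    · have e1 : d * 1 ≤ d * x := Nat.mul_le_mul_left _ hx0
      have e2 : d * (x + 1) ≤ d * m := Nat.mul_le_mul_left _ hx
      have e3 : d * (x + 1) = d * x + d := by ring
      have := H (d * x + lp - t) (by omega)
      apply h.tail_inj
      rw [← hd, mul_add, mul_add]
      convert this using 2 <;> omega

lemma exists_preimage {i k d lp : ℕ} (hd : 0 < d) (hk : lp ≤ k)
    (hmod : 2 * i + k ≡ lp [MOD d]) :
    ∃ n m t, t < d ∧ k + 2 * t = d * m + lp ∧ i = d * n + t := by
  obtain ⟨e, he⟩ : ∃ e, 2 * i + k = d * e + lp := by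
    obtain ⟨e, he⟩ := (Nat.modEq_iff_dvd' (by omega)).1 hmod.symm
    exact ⟨e, by omega⟩
  have h1 := Nat.div_add_mod i d
  have h2 := Nat.mod_lt i hd
  have hle : 2 * (i / d) ≤ e := by
    have : d * (2 * (i / d)) ≤ d * e := by
      have : d * (2 * (i / d)) = 2 * (d * (i / d)) := by ring
      omega
    exact Nat.le_of_mul_le_mul_left this hd
  obtain ⟨m, rfl⟩ := Nat.exists_eq_add_of_le hle
  refine ⟨i / d, m, i % d, h2, ?_, h1.symm⟩
  have : d * (2 * (i / d) + m) = 2 * (d * (i / d)) + d * m := by ring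
  omega

/-- Desubstitution: the palindromes of a large length `k` correspond to those of length about
`k / (lp + lq)`. -/
lemma palComplexity_eq_of_large (h : IsClassPSeq u lp lq) {L : ℕ}
    (hL : ∀ i k, L ≤ k → PalAt u i k → 2 * i + k ≡ lp [MOD lp + lq]) {k m : ℕ}
    (hk : (lp + lq) * (L + 2) + lp ≤ k) (hkm : k ≤ (lp + lq) * m + lp)
    (hmk : (lp + lq) * m + lp < k + 2 * (lp + lq)) (hpar : ((lp + lq) * m + lp) % 2 = k % 2)
    (heven : (lp + lq) % 2 = 0 → m % 2 = lp % 2) :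
    palComplexity u k = palComplexity u m := by
  have hlq := h.lq_pos
  set d := lp + lq with hd
  have large : ∀ m, k ≤ d * m + lp → L + 2 ≤ m := fun m hm =>
    Nat.le_of_mul_le_mul_left (show d * (L + 2) ≤ d * m by omega) (by omega)
  have hLk : L + 2 ≤ k := by
    have := Nat.le_mul_of_pos_left (L + 2) (show 0 < d by omega)
    omega
  have hm := large m hkm
  obtain ⟨t, ht⟩ : ∃ t, k + 2 * t = d * m + lp := ⟨(d * m + lp - k) / 2, by omega⟩
  rw [palComplexity_eq, palComplexity_eq]
  symm
  refine ncard_image_eq_ncard_image (fun n => d * n + t) ?_ fun n _ n' _ =>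
    h.factorAt_image_eq_iff (by omega) (by omega) ht
  ext i
  constructor
  · rintro ⟨n, hn, rfl⟩ x y hx hy hxy
    have himg := h.palAt_image hn
    rw [← hd] at himg
    dsimp only at hx hy hxy
    exact himg x y (by omega) (by omega) (by omega)
  · intro hi
    obtain ⟨n, m', t', ht', hk', rfl⟩ :=
      exists_preimage (show 0 < d by omega) (by omega) (hL i k (by omega) hi)
    have hm' := large m' (by omega)
    have hn : PalAt u n m' := h.palAt_of_image (by omega) ht' hk' hi
    have hmm : m % 2 = m' % 2 := by
      have hpar' : (d * m' + lp) % 2 = k % 2 := by omega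
      rcases Nat.even_or_odd' d with ⟨c, hc | hc⟩
      · have h1 := (hL n m' (by omega) hn).of_dvd ⟨c, hc⟩
        have h2 := heven (by omega)
        simp only [Nat.ModEq] at h1
        omega
      · have e1 : d * m = 2 * (c * m) + m := by rw [hc]; ring
        have e2 : d * m' = 2 * (c * m') + m' := by rw [hc]; ring
        omega
    have hle : ∀ m m', m % 2 = m' % 2 → d * m + lp < k + 2 * d → k ≤ d * m' + lp → m ≤ m' := by
      intro m m' h0 h1 h2
      by_contra! h3
      have e1 : d * (m' + 2) ≤ d * m := Nat.mul_le_mul_left _ (by omega)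
      have e2 : d * (m' + 2) = d * m' + 2 * d := by ring
      omega
    obtain rfl : m = m' := le_antisymm (hle _ _ hmm hmk (by omega))
      (hle _ _ hmm.symm (by omega) hkm)
    obtain rfl : t = t' := by omega
    exact ⟨n, hn, rfl⟩

lemma exists_length {d k lp : ℕ} (hd : 0 < d) (hk : lp ≤ k)
    (hpar : d % 2 = 0 → k % 2 = lp % 2) :
    ∃ m, k ≤ d * m + lp ∧ d * m + lp < k + 2 * d ∧ (d * m + lp) % 2 = k % 2 ∧
      (d % 2 = 0 → m % 2 = lp % 2) := by
  have h1 := Nat.div_add_mod (k - lp + d - 1) d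
  have h2 := Nat.mod_lt (k - lp + d - 1) hd
  set c := (k - lp + d - 1) / d
  have e1 : d * (c + 1) = d * c + d := by ring
  rcases Nat.even_or_odd' d with ⟨b, hb | hb⟩
  · have e2 : ∀ m, d * m = 2 * (b * m) := fun m => by rw [hb]; ring
    by_cases hc : c % 2 = lp % 2
    · exact ⟨c, by omega, by omega, by have := e2 c; omega, fun _ => hc⟩
    · exact ⟨c + 1, by omega, by omega, by have := e2 (c + 1); omega, fun _ => by omega⟩
  · have e2 : ∀ m, d * m = 2 * (b * m) + m := fun m => by rw [hb]; ring
    by_cases hc : (c + lp) % 2 = k % 2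
    · exact ⟨c, by omega, by omega, by have := e2 c; omega, fun _ => by omega⟩
    · exact ⟨c + 1, by omega, by omega, by have := e2 (c + 1); omega, fun _ => by omega⟩

lemma palComplexity_eq_zero {d L : ℕ}
    (hL : ∀ i k, L ≤ k → PalAt u i k → 2 * i + k ≡ lp [MOD d]) (hd : d % 2 = 0) {k : ℕ}
    (hk : L ≤ k) (hpar : k % 2 ≠ lp % 2) : palComplexity u k = 0 := by
  have : {i | PalAt u i k} = ∅ := by
    ext i
    simp only [Set.mem_ofPred_eq, Set.mem_empty_iff_false, iff_false]
    intro hi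
    have := (hL i k hk hi).of_dvd (Nat.dvd_of_mod_eq_zero hd)
    simp only [Nat.ModEq] at this
    omega
  rw [palComplexity_eq, this, Set.image_empty, Set.ncard_empty]

lemma isAutomaticSeq_palComplexity (h : IsClassPSeq u lp lq) (hd2 : 2 ≤ lp + lq) {L : ℕ}
    (hL : ∀ i k, L ≤ k → PalAt u i k → 2 * i + k ≡ lp [MOD lp + lq]) :
    IsAutomaticSeq (lp + lq) (fun k => palComplexity u (k + 1)) := by
  have hlq := h.lq_pos
  have hlarge := fun k m => h.palComplexity_eq_of_large (k := k) (m := m) hL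
  have hzero := fun k => palComplexity_eq_zero (k := k) hL
  set d := lp + lq with hd
  set K := d * (L + 2) + lp with hK
  have hLK : 2 * (L + 2) ≤ d * (L + 2) := Nat.mul_le_mul_right _ hd2
  refine isAutomaticSeq_of_transfer (by omega) _ K ?_ ?_
  · refine (((Set.finite_Iio K).image (palComplexity u)).union
      (Set.finite_singleton 0)).subset ?_
    rintro _ ⟨k, rfl⟩
    induction k using Nat.strong_induction_on with
    | _ k ih =>
      rcases lt_or_ge k K with hk | hk
      · exact Or.inl ⟨k, hk, rfl⟩
      by_cases hpar : d % 2 = 0 ∧ k % 2 ≠ lp % 2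
      · exact Or.inr (hzero k hpar.1 (by omega) hpar.2)
      obtain ⟨m, h1, h2, h3, h4⟩ := exists_length (d := d) (k := k) (lp := lp) (by omega)
        (by omega) (fun h0 => by by_contra h'; exact hpar ⟨h0, h'⟩)
      rw [hlarge k m hk h1 h2 h3 h4]
      apply ih
      by_contra! hc
      obtain ⟨c, rfl⟩ : ∃ c, m = c + 2 := ⟨m - 2, by omega⟩
      have e1 : d * (c + 2) = d * c + 2 * d := by ring
      have e2 := Nat.mul_le_mul_right c hd2
      omega
  · intro n n' hn hn' hpar hP r hr
    have en : K ≤ d * n := hn.trans (Nat.le_mul_of_pos_left _ (by omega))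
    have en' : K ≤ d * n' := hn'.trans (Nat.le_mul_of_pos_left _ (by omega))
    have hpp : (d * n) % 2 = (d * n') % 2 := by simp [Nat.mul_mod, hpar]
    have hrr : (d * n + r) % 2 = (d * n' + r) % 2 := by rw [Nat.add_mod, hpp, ← Nat.add_mod]
    by_cases hev : d % 2 = 0 ∧ (d * n + r) % 2 ≠ lp % 2
    · rw [hzero _ hev.1 (by omega) hev.2, hzero _ hev.1 (by omega) (hrr ▸ hev.2)]
    obtain ⟨m, h1, h2, h3, h4⟩ := exists_length (d := d) (k := d * n + r) (lp := lp) (by omega)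
      (by omega) (fun h0 => by by_contra h'; exact hev ⟨h0, h'⟩)
    clear hev hrr
    have hnm : n ≤ m := by
      by_contra! hc
      have := Nat.mul_le_mul_left d hc
      rw [Nat.succ_eq_add_one, mul_add] at this
      clear h3 h4 hpar hpp
      omega
    obtain ⟨j, rfl⟩ := Nat.exists_eq_add_of_le hnm
    have hj : j < 6 := by
      by_contra! hc
      have e1 := Nat.mul_le_mul_left d hc
      rw [mul_add] at h2
      clear h1 h3 h4 hpar hpp
      omega
    have e2 : d * (n + j) = d * n + d * j := by ring
    have e3 : d * (n' + j) = d * n' + d * j := by ring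
    have h3' : (d * (n' + j) + lp) % 2 = (d * n' + r) % 2 := by
      rw [e3]; rw [e2] at h3
      clear h1 h2 h4
      omega
    have h4' : d % 2 = 0 → (n' + j) % 2 = lp % 2 := fun h0 => by
      rw [← h4 h0, Nat.add_mod, ← hpar, ← Nat.add_mod]
    rw [hlarge _ (n + j) (by omega) h1 h2 h3 h4, hP j hj]
    clear h3 h4 hpar hpp
    exact (hlarge _ (n' + j) (by omega) (by omega) (by omega) h3' h4').symm

end IsClassPSeq

lemma isClassPSeq_of_morphism {σ : α → List α} {u : ℕ → α} {p : List α}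
    (hp : IsPalindrome p) {q : α → List α} (hq : ∀ a, IsPalindrome (q a))
    (hσ : ∀ a, σ a = p ++ q a) {lq : ℕ} (hlq : ∀ a, (q a).length = lq)
    (hdist : ∀ a b : α, a ≠ b → (q a).head? ≠ (q b).head?) (hpos : 0 < lq)
    (hblock : ∀ n, σ (u n) = factorAt u ((p.length + lq) * n) (p.length + lq)) :
    IsClassPSeq u p.length lq := by
  have hget : ∀ n j, j < p.length + lq →
      (p ++ q (u n))[j]? = some (u ((p.length + lq) * n + j)) := by
    intro n j hj
    rw [← hσ, hblock]
    simp [factorAt, hj]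
  have hpre : ∀ n j, j < p.length → p[j]? = some (u ((p.length + lq) * n + j)) := by
    intro n j hj
    rw [← hget n j (by omega), List.getElem?_append_left hj]
  have htail : ∀ n j, j < lq →
      (q (u n))[j]? = some (u ((p.length + lq) * n + p.length + j)) := by
    intro n j hj
    rw [add_assoc, ← hget n (p.length + j) (by omega),
      List.getElem?_append_right (by omega), Nat.add_sub_cancel_left]
  have hrev : ∀ (w : List α) j, IsPalindrome w → j < w.length →
      w[j]? = w[w.length - 1 - j]? := by
    intro w j hw hj
    conv_lhs => rw [← show w.reverse = w from hw]
    rw [List.getElem?_reverse hj]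
  refine ⟨hpos, fun n n' j hj => ?_, fun n n' j hj hn => ?_, fun n n' hn => ?_⟩
  · apply Option.some_injective
    rw [← hpre n j hj, ← hpre n' _ (by omega), hrev p j hp hj]
  · apply Option.some_injective
    rw [← htail n j hj, ← htail n' _ (by omega), hrev _ j (hq _) (by rwa [hlq]), hlq, hn]
  · by_contra hne
    apply hdist _ _ hne
    rw [List.head?_eq_getElem?, List.head?_eq_getElem?, htail n 0 hpos, htail n' 0 hpos,
      add_zero, add_zero, hn]

/-- The palindrome complexity sequence `(pal_u(k))_{k ≥ 1}` of a fixed point of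
a `d`-uniform primitive class-P morphism `σ a = p ++ q a` (with the `q a`
having pairwise distinct first letters) is `d`-automatic. -/
theorem stmt11 {α : Type*} [Fintype α] (σ : α → List α) (hprim : IsPrimitive σ)
    (u : ℕ → α) (hfix : IsFixedPointOf σ u)
    (p : List α) (hp : IsPalindrome p)
    (q : α → List α) (hq : ∀ a, IsPalindrome (q a))
    (hσ : ∀ a, σ a = p ++ q a)
    (lq : ℕ) (hlq : ∀ a, (q a).length = lq)
    (hdist : ∀ a b : α, a ≠ b → (q a).head? ≠ (q b).head?) :
    IsAutomaticSeq (p.length + lq) (fun k => palComplexity u (k + 1)) := by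
  have hlen : ∀ a, (σ a).length = p.length + lq := fun a => by simp [hσ, hlq]
  have hblock := (isFixedPointOf_iff_of_uniform hlen u).1 hfix
  obtain ⟨k, hk, hprim⟩ := hprim
  have hrec : ∀ n b, ∃ r < (p.length + lq) ^ k, u ((p.length + lq) ^ k * n + r) = b :=
    fun n b => exists_eq_of_mem_morphIter hblock k n (hprim _ _)
  have hd : 0 < p.length + lq := by
    by_contra h0
    obtain ⟨r, hr, -⟩ := hrec 0 (u 0)
    rw [Nat.eq_zero_of_not_pos h0, zero_pow (by omega)] at hr
    omega
  by_cases hpred : ∀ s t, u (s + 1) = u (t + 1) → u s = u t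
  · have hex : ∀ b, ∃ n, u (n + 1) = b := by
      intro b
      obtain ⟨r, -, hr⟩ := hrec 1 b
      have : 0 < (p.length + lq) ^ k := by positivity
      exact ⟨(p.length + lq) ^ k * 1 + r - 1, by rw [← hr]; congr 1; omega⟩
    choose c hc using hex
    have hf : ∀ n, u (c (u (n + 1))) = u n := fun n => hpred _ _ (hc _)
    have hinj : Function.Injective fun b => u (c b) := by
      refine Finite.injective_iff_surjective.2 fun b => ⟨u (c b + 1 + 1), ?_⟩
      exact (hf _).trans (hc b)
    have hsucc : ∀ s t, u s = u t → u (s + 1) = u (t + 1) := fun s t h =>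
      hinj (((hf s).trans h).trans (hf t).symm)
    have key := fun k k' => palComplexity_congr_of_deterministic hpred hsucc (k := k) (k' := k')
    refine isAutomaticSeq_of_transfer hd _ 2 ?_ ?_
    · refine ((Set.finite_Iio 4).image (palComplexity u)).subset ?_
      rintro _ ⟨n, rfl⟩
      rcases lt_or_ge n 2 with hn | hn
      · exact ⟨n, Set.mem_Iio.2 (by omega), rfl⟩
      · exact ⟨2 + n % 2, Set.mem_Iio.2 (by omega), key _ _ (by omega) hn (by omega)⟩
    · intro n n' hn hn' hpar _ r _
      have h1 := Nat.le_mul_of_pos_left n hd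
      have h2 := Nat.le_mul_of_pos_left n' hd
      exact key _ _ (by omega) (by omega) (by simp [Nat.add_mod, Nat.mul_mod, hpar])
  · push Not at hpred
    obtain ⟨s, t, hst', hst⟩ := hpred
    have hpos : 0 < lq := by
      by_contra h0
      have hnil : ∀ a, q a = [] := fun a =>
        List.eq_nil_of_length_eq_zero ((hlq a).trans (Nat.eq_zero_of_not_pos h0))
      exact hdist _ _ hst (by rw [hnil, hnil])
    have hd2 : 2 ≤ p.length + lq := by
      by_contra h0
      have h1 : p.length + lq = 1 := by omega
      simp only [h1, one_pow, one_mul, Nat.lt_one_iff, exists_eq_left, add_zero] at hrec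
      exact hst ((hrec s _))
    have hP := isClassPSeq_of_morphism hp hq hσ hlq hdist hpos hblock
    obtain ⟨L, hL⟩ := hP.exists_center_bound hst hst' fun s =>
      exists_recurrence_bound hd2 (fun n n' j hn hj => hP.block_congr hn (by omega)) hrec s
    exact hP.isAutomaticSeq_palComplexity hd2 hL

end PalPaper
end
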